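/- For every integer s ≥ 4, the polynomial Λ(t) = t⁴/24 + (1/864)(−30s + 67s² − 48s³ + 11s⁴) + (1/864)(−48s + 72s² − 24s³)·t has no real roots; equivalently, Λ(t) > 0 for all real t. -/

import Mathlib

/-- For every integer s ≥ 4, the quartic
Λ(t) = t⁴/24 + (1/864)(−30s + 67s² − 48s³ + 11s⁴) + (1/864)(−48s + 72s² − 24s³)t
is strictly positive for all real t (hence has no real roots). -/
theorem stmt_9 (s : ℤ) (hs : 4 ≤ s) (t : ℝ) :
    0 < t ^ 4 / 24
        + (1 / 864) * (-30 * (s : ℝ) + 67 * (s : ℝ) ^ 2 - 48 * (s : ℝ) ^ 3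
            + 11 * (s : ℝ) ^ 4)
        + (1 / 864) * (-48 * (s : ℝ) + 72 * (s : ℝ) ^ 2 - 24 * (s : ℝ) ^ 3) * t := by
  obtain ⟨u, hu, hsu⟩ : ∃ u : ℝ, 0 ≤ u ∧ (s : ℝ) = u + 4 := by
    have h : (4 : ℝ) ≤ (s : ℝ) := by exact_mod_cast hs
    exact ⟨(s : ℝ) - 4, by linarith, by ring⟩
  rw [hsu]
  obtain ⟨b, hb⟩ : ∃ b : ℝ, b = (3 * u ^ 2 + 18 * u + 25) / 10 := ⟨_, rfl⟩
  have hbpos : 0 < b := by rw [hb]; positivity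
  obtain ⟨P, hP⟩ : ∃ P : ℝ, P = (u + 4) * (u + 3) * (u + 2) := ⟨_, rfl⟩
  have key : 0 < b * (P * (11 * u + 29) - 36 * b ^ 2) - 2 * P ^ 2 := by
    rw [hb, hP]
    ring_nf
    positivity
  have h2 : 0 < 72 * b * (36 * t ^ 4 + P * (11 * u + 29) - 24 * P * t) := by
    have h3 : 0 ≤ b * (t ^ 2 - b) ^ 2 := by positivity
    nlinarith [sq_nonneg (72 * b * t - 12 * P)]
  have h4 := pos_of_mul_pos_right h2 (by positivity)
  rw [hP] at h4
  nlinarith [h4]
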